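/- Let K be an algebraically closed field of characteristic 0, g = (V, φ₀) a finite-dimensional Lie algebra with V = K^m, 𝒜 an admissible set at φ₀ with V²_𝒜 the span of {e_k^{ij} : (i,j,k) ∈ ℐ∖𝒜}, W¹ ⊆ End_K(V) a linear complement of Z¹(g,g) = Der(g) in End_K(V), and A a Noetherian complete local K-algebra with maximal ideal 𝔪 and residue field K. Then the map f(w,v) := (id+w)∘(φ₀+v)∘((id+w)⁻¹ × (id+w)⁻¹) − φ₀ is a bijection from (𝔪⊗W¹) × (𝔪⊗V²_𝒜) onto 𝔪⊗C²(V,V). -/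

import Mathlib

section Stmt5

/-- Bilinearity of a raw map over a commutative ring. -/
def IsBilin (A : Type) [CommRing A] {M : Type} [AddCommGroup M] [Module A M]
    (f : M → M → M) : Prop :=
  (∀ (a : A) (x x' y : M), f (a • x + x') y = a • f x y + f x' y) ∧
  (∀ (a : A) (x y y' : M), f x (a • y + y') = a • f x y + f x y')

/-- Linearity of a raw map. -/
def IsLin (A : Type) [CommRing A] {M : Type} [AddCommGroup M] [Module A M]
    (L : M → M) : Prop :=
  ∀ (a : A) (x y : M), L (a • x + y) = a • L x + L y

/-- The basis 2-cochain `e_k^{ij}` of `C²(K^m, K^m)`. -/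
def ekij {K : Type} [Field K] {m : ℕ} (i j k : Fin m) :
    (Fin m → K) → (Fin m → K) → (Fin m → K) :=
  fun x y => (x i * y j - x j * y i) • (Pi.single k 1 : Fin m → K)

/-- The 2-coboundary `dL` of `L ∈ C¹`, for the bracket `φ₀`:
`(x,y) ↦ [x,Ly] − [y,Lx] − L([x,y])`. -/
def cob {K : Type} [Field K] {m : ℕ}
    (φ₀ : (Fin m → K) → (Fin m → K) → (Fin m → K)) (L : (Fin m → K) → (Fin m → K)) :
    (Fin m → K) → (Fin m → K) → (Fin m → K) :=
  fun x y => φ₀ x (L y) - φ₀ y (L x) - L (φ₀ x y)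

/-- `id + W`, for a matrix `W` over `A`. -/
def matMap {A : Type} [CommRing A] {m : ℕ} (W : Fin m → Fin m → A) (x : Fin m → A) :
    Fin m → A :=
  fun k => x k + ∑ j : Fin m, W k j * x j

/-! ### Structure constants -/

/-- the bilinear map with given structure constants -/
def toB {B : Type} [CommRing B] {m : ℕ} (c : Fin m → Fin m → Fin m → B)
    (x y : Fin m → B) : Fin m → B :=
  fun k => ∑ i : Fin m, ∑ j : Fin m, x i * y j * c i j k

/-- structure constants of a bilinear map -/
def coef {B : Type} [CommRing B] {m : ℕ} (f : (Fin m → B) → (Fin m → B) → (Fin m → B)) :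
    Fin m → Fin m → Fin m → B :=
  fun i j k => f (Pi.single i 1) (Pi.single j 1) k

lemma isBilin_toB {B : Type} [CommRing B] {m : ℕ} (c : Fin m → Fin m → Fin m → B) :
    IsBilin B (toB c) := by
  constructor
  · intro a x x' y
    ext k
    simp only [toB, Pi.add_apply, Pi.smul_apply, smul_eq_mul, Finset.mul_sum,
      ← Finset.sum_add_distrib]
    refine Finset.sum_congr rfl fun i _ => Finset.sum_congr rfl fun j _ => ?_
    ring
  · intro a x x' y
    ext k
    simp only [toB, Pi.add_apply, Pi.smul_apply, smul_eq_mul, Finset.mul_sum,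
      ← Finset.sum_add_distrib]
    refine Finset.sum_congr rfl fun i _ => Finset.sum_congr rfl fun j _ => ?_
    ring

/-- bundle a bilinear map -/
def bund {B : Type} [CommRing B] {m : ℕ} (f : (Fin m → B) → (Fin m → B) → (Fin m → B))
    (h : IsBilin B f) : (Fin m → B) →ₗ[B] (Fin m → B) →ₗ[B] (Fin m → B) :=
  LinearMap.mk₂ B f
    (fun x x' y => by simpa using h.1 1 x x' y)
    (fun a x y => by
      have h0 : f 0 y = 0 := by simpa using h.1 (-1) 0 0 y
      have := h.1 a x 0 y
      simpa [h0] using this)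
    (fun x y y' => by simpa using h.2 1 x y y')
    (fun a x y => by
      have h0 : f x 0 = 0 := by simpa using h.2 (-1) x 0 0
      have := h.2 a x y 0
      simpa [h0] using this)

/-- bundle a linear map -/
def bundL {B : Type} [CommRing B] {m : ℕ} (f : (Fin m → B) → (Fin m → B))
    (h : IsLin B f) : (Fin m → B) →ₗ[B] (Fin m → B) where
  toFun := f
  map_add' x y := by simpa using h 1 x y
  map_smul' a x := by
    have h0 : f 0 = 0 := by simpa using h (-1) 0 0
    simpa [h0] using h a x 0

lemma isBilin_ext {B : Type} [CommRing B] {m : ℕ}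
    {f g : (Fin m → B) → (Fin m → B) → (Fin m → B)}
    (hf : IsBilin B f) (hg : IsBilin B g) (h : coef f = coef g) : f = g := by
  have : bund f hf = bund g hg := by
    apply LinearMap.pi_ext'
    intro i
    apply LinearMap.ext_ring
    apply LinearMap.pi_ext'
    intro j
    apply LinearMap.ext_ring
    ext k
    exact congrFun (congrFun (congrFun h i) j) k
  ext x y k
  exact congrFun (LinearMap.congr_fun (LinearMap.congr_fun this x) y) k

lemma isLin_ext {B : Type} [CommRing B] {m : ℕ}
    {f g : (Fin m → B) → (Fin m → B)}
    (hf : IsLin B f) (hg : IsLin B g)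
    (h : ∀ i, f (Pi.single i 1) = g (Pi.single i 1)) : f = g := by
  have : bundL f hf = bundL g hg := by
    apply LinearMap.pi_ext'
    intro i
    apply LinearMap.ext_ring
    exact h i
  ext x k
  exact congrFun (LinearMap.congr_fun this x) k

lemma coef_toB {B : Type} [CommRing B] {m : ℕ} (c : Fin m → Fin m → Fin m → B) :
    coef (toB c) = c := by
  ext i j k
  simp [coef, toB, Pi.single_apply]

lemma toB_coef {B : Type} [CommRing B] {m : ℕ}
    {f : (Fin m → B) → (Fin m → B) → (Fin m → B)} (hf : IsBilin B f) : toB (coef f) = f :=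
  isBilin_ext (isBilin_toB _) hf (coef_toB _)

lemma bilin_anti {B : Type} [CommRing B] {m : ℕ}
    {f : (Fin m → B) → (Fin m → B) → (Fin m → B)} (hf : IsBilin B f) (ha : ∀ x, f x x = 0)
    (x y : Fin m → B) : f x y = - f y x := by
  have h := ha ((1 : B) • x + y)
  rw [hf.1, hf.2, hf.2, ha, ha] at h
  simp only [one_smul, zero_add, add_zero] at h
  exact eq_neg_of_add_eq_zero_left h

lemma toB_alt (K : Type) [Field K] [CharZero K] {B : Type} [CommRing B] [Algebra K B] {m : ℕ}
    {c : Fin m → Fin m → Fin m → B} (hc : ∀ i j k, c i j k = - c j i k) (x : Fin m → B) :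
    toB c x x = 0 := by
  ext k
  have h1 : toB c x x k = - toB c x x k := by
    conv_lhs => unfold toB; rw [Finset.sum_comm]
    simp only [toB, ← Finset.sum_neg_distrib]
    refine Finset.sum_congr rfl fun i _ => Finset.sum_congr rfl fun j _ => ?_
    rw [hc j i]; ring
  have h2 : (2 : K) • toB c x x k = 0 := by
    rw [two_smul]
    nth_rewrite 1 [h1]
    simp
  have := congrArg (fun z => (2 : K)⁻¹ • z) h2
  simpa [smul_smul] using this

/-! ### Fixed point lemma -/

lemma fixed_point {A : Type} [CommRing A] (I : Ideal A) (hc : IsAdicComplete I A) {m : ℕ}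
    (H : (Fin m → Fin m → Fin m → A) → (Fin m → Fin m → Fin m → A))
    (H0 : ∀ c, (∀ i j k, c i j k ∈ I) → ∀ i j k, H c i j k ∈ I)
    (H1 : ∀ c c', (∀ i j k, c i j k ∈ I) → (∀ i j k, c' i j k ∈ I) → ∀ n : ℕ,
      (∀ i j k, c i j k - c' i j k ∈ I ^ n) → ∀ i j k, H c i j k - H c' i j k ∈ I ^ (n + 1)) :
    ∃! c, (∀ i j k, c i j k ∈ I) ∧ H c = c := by
  have haus : ∀ x : A, (∀ n, x ∈ I ^ n) → x = 0 := by
    intro x hx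
    apply hc.toIsHausdorff.haus
    intro n
    rw [SModEq.sub_mem]
    simpa using hx n
  have prec : ∀ f : ℕ → A, (∀ n, f n - f (n + 1) ∈ I ^ n) → ∃ L, ∀ n, f n - L ∈ I ^ n := by
    intro f hf
    have hf' : ∀ a b, f a - f (a + b) ∈ I ^ a := by
      intro a b
      induction b with
      | zero => simp
      | succ b ih =>
        have h2 := Ideal.pow_le_pow_right (Nat.le_add_right a b) (hf (a + b))
        have := Ideal.add_mem _ ih h2
        simpa [add_assoc] using this
    obtain ⟨L, hL⟩ := hc.toIsPrecomplete.prec (f := f) (by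
      intro a b hab
      obtain ⟨b, rfl⟩ := Nat.exists_eq_add_of_le hab
      rw [SModEq.sub_mem]
      simpa using hf' a b)
    refine ⟨L, fun n => ?_⟩
    have := hL n
    rw [SModEq.sub_mem] at this
    simpa using this
  let x : ℕ → (Fin m → Fin m → Fin m → A) := fun n => H^[n] 0
  have xs : ∀ n, x (n + 1) = H (x n) := fun n => Function.iterate_succ_apply' H n 0
  have xm : ∀ n i j k, x n i j k ∈ I := by
    intro n
    induction n with
    | zero => intro i j k; simp [x]
    | succ n ih => rw [xs]; exact H0 _ ih
  have xd : ∀ n i j k, x n i j k - x (n + 1) i j k ∈ I ^ n := by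
    intro n
    induction n with
    | zero => intro i j k; simp
    | succ n ih => rw [xs (n + 1)]; nth_rewrite 1 [xs n]; exact H1 _ _ (xm _) (xm _) n ih
  choose c hcc using fun i j k => prec (fun n => x n i j k) (fun n => xd n i j k)
  have cm : ∀ i j k, c i j k ∈ I := by
    intro i j k
    have h := hcc i j k 1
    rw [pow_one] at h
    have := Ideal.sub_mem _ (xm 1 i j k) h
    simpa using this
  refine ⟨c, ⟨cm, ?_⟩, ?_⟩
  · ext i j k
    rw [← sub_eq_zero]
    apply haus
    intro n
    have h1 := H1 _ _ (xm n) cm n (fun i j k => hcc i j k n) i j k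
    have h2 := hcc i j k (n + 1)
    rw [← xs] at h1
    have := Ideal.sub_mem _ h2 h1
    apply Ideal.pow_le_pow_right (Nat.le_succ n)
    simpa using this
  · rintro c' ⟨cm', h'⟩
    have key : ∀ n i j k, c' i j k - c i j k ∈ I ^ n := by
      have hfix : H c = c := by
        ext i j k
        rw [← sub_eq_zero]
        apply haus
        intro n
        have h1 := H1 _ _ (xm n) cm n (fun i j k => hcc i j k n) i j k
        have h2 := hcc i j k (n + 1)
        rw [← xs] at h1
        have := Ideal.sub_mem _ h2 h1
        apply Ideal.pow_le_pow_right (Nat.le_succ n)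
        simpa using this
      intro n
      induction n with
      | zero => intro i j k; simp
      | succ n ih =>
        have := H1 _ _ cm' cm n ih
        rwa [h', hfix] at this
    ext i j k
    rw [← sub_eq_zero]
    exact haus _ fun n => key n i j k

/-! ### The linearised problem -/

/-- the coboundary in coordinates -/
def dd {K : Type} [Field K] {B : Type} [CommRing B] [Algebra K B] {m : ℕ}
    (p : Fin m → Fin m → Fin m → K) (W : Fin m → Fin m → B) : Fin m → Fin m → Fin m → B :=
  fun i j k => ∑ l, p i l k • W l j - ∑ l, p j l k • W l i - ∑ l, p i j l • W k l

/-- the coboundary over the field, as a linear map -/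
def ddL {K : Type} [Field K] {m : ℕ} (p : Fin m → Fin m → Fin m → K) :
    (Fin m → Fin m → K) →ₗ[K] (Fin m → Fin m → Fin m → K) where
  toFun := dd p
  map_add' W W' := by
    ext i j k
    simp only [dd, Pi.add_apply, smul_add, Finset.sum_add_distrib]
    ring
  map_smul' a W := by
    ext i j k
    simp only [dd, Pi.smul_apply, smul_eq_mul, RingHom.id_apply, mul_sub, Finset.mul_sum,
      mul_left_comm]

lemma lin_split {K M T : Type} [Field K] [AddCommGroup M] [Module K M] [AddCommGroup T]
    [Module K T] (U : Submodule K M) (V Alt : Submodule K T) (d : M →ₗ[K] T)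
    (hinj : ∀ w ∈ U, ∀ v ∈ V, v = d w → w = 0 ∧ v = 0)
    (hsurj : ∀ c ∈ Alt, ∃ w ∈ U, ∃ v ∈ V, c = v - d w) :
    ∃ (r1 : T →ₗ[K] M) (r2 : T →ₗ[K] T), (∀ c, r1 c ∈ U) ∧ (∀ c, r2 c ∈ V) ∧
      (∀ c ∈ Alt, r2 c - d (r1 c) = c) ∧
      (∀ w ∈ U, ∀ v ∈ V, r1 (v - d w) = w ∧ r2 (v - d w) = v) := by
  let L : (U × V) →ₗ[K] T :=
    V.subtype ∘ₗ LinearMap.snd K U V - d ∘ₗ U.subtype ∘ₗ LinearMap.fst K U V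
  have hL : LinearMap.ker L = ⊥ := by
    rw [LinearMap.ker_eq_bot']
    rintro ⟨⟨w, hw⟩, ⟨v, hv⟩⟩ h
    have h' : v - d w = 0 := h
    obtain ⟨h1, h2⟩ := hinj w hw v hv (sub_eq_zero.mp h')
    subst h1 h2
    rfl
  obtain ⟨g, hg⟩ := LinearMap.exists_leftInverse_of_injective L hL
  have key : ∀ w (hw : w ∈ U) v (hv : v ∈ V), g (v - d w) = (⟨w, hw⟩, ⟨v, hv⟩) :=
    fun w hw v hv => LinearMap.congr_fun hg (⟨w, hw⟩, ⟨v, hv⟩)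
  refine ⟨U.subtype ∘ₗ LinearMap.fst K U V ∘ₗ g, V.subtype ∘ₗ LinearMap.snd K U V ∘ₗ g,
    fun c => (g c).1.2, fun c => (g c).2.2, ?_, ?_⟩
  · intro c hc
    obtain ⟨w, hw, v, hv, rfl⟩ := hsurj c hc
    simp [key w hw v hv]
  · intro w hw v hv
    simp [key w hw v hv]

/-- scalar extension of a linear map out of tensors, at one output coordinate -/
def extR {K : Type} [Field K] {B : Type} [CommRing B] [Algebra K B] {m : ℕ}
    (r : (Fin m → Fin m → Fin m → K) →ₗ[K] K) (c : Fin m → Fin m → Fin m → B) : B :=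
  ∑ i, ∑ j, ∑ k, r (Pi.single i (Pi.single j (Pi.single k 1))) • c i j k

lemma extR_dual {K : Type} [Field K] {B : Type} [CommRing B] [Algebra K B] {m : ℕ}
    (r : (Fin m → Fin m → Fin m → K) →ₗ[K] K) (c : Fin m → Fin m → Fin m → B)
    (f : B →ₗ[K] K) : f (extR r c) = r (fun i j k => f (c i j k)) := by
  have : (fun i j k => f (c i j k)) =
      ∑ i, ∑ j, ∑ k, f (c i j k) • 
        (Pi.single i (Pi.single j (Pi.single k 1)) : Fin m → Fin m → Fin m → K) := by
    ext i j k
    simp only [Finset.sum_apply, Pi.smul_apply]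
    rw [Finset.sum_eq_single i, Finset.sum_eq_single j, Finset.sum_eq_single k] <;> 
      simp +contextual [Pi.single_apply, eq_comm]
  rw [this]
  simp [extR, map_sum, map_smul, mul_comm]

lemma dd_dual {K : Type} [Field K] {B : Type} [CommRing B] [Algebra K B] {m : ℕ}
    (p : Fin m → Fin m → Fin m → K) (W : Fin m → Fin m → B) (f : B →ₗ[K] K) (i j k : Fin m) :
    f (dd p W i j k) = dd p (fun a b => f (W a b)) i j k := by
  simp [dd, map_sum, map_smul]

lemma eq_of_dual {K : Type} [Field K] {B : Type} [CommRing B] [Algebra K B] {x y : B}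
    (h : ∀ f : B →ₗ[K] K, f x = f y) : x = y := by
  rw [← sub_eq_zero, ← Module.forall_dual_apply_eq_zero_iff K]
  intro f
  rw [map_sub, h, sub_self]

/-- the linear map of a matrix -/
def toLL (K : Type) [Field K] (m : ℕ) :
    (Fin m → Fin m → K) →ₗ[K] ((Fin m → K) → (Fin m → K)) where
  toFun W := fun x k => ∑ j, W k j * x j
  map_add' W W' := by
    ext x k
    simp [add_mul, Finset.sum_add_distrib]
  map_smul' a W := by
    ext x k
    simp [Finset.mul_sum, mul_assoc]

lemma toLL_apply {K : Type} [Field K] {m : ℕ} (W : Fin m → Fin m → K) (x : Fin m → K)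
    (k : Fin m) : toLL K m W x k = ∑ j, W k j * x j := rfl

lemma toLL_single {K : Type} [Field K] {m : ℕ} (W : Fin m → Fin m → K) (j : Fin m) :
    toLL K m W (Pi.single j 1) = fun k => W k j := by
  ext k
  simp [toLL_apply, Pi.single_apply]

lemma isLin_toLL {K : Type} [Field K] {m : ℕ} (W : Fin m → Fin m → K) :
    IsLin K (toLL K m W) := by
  intro a x y
  ext k
  simp only [toLL_apply, Pi.add_apply, Pi.smul_apply, smul_eq_mul, Finset.mul_sum,
    ← Finset.sum_add_distrib]
  refine Finset.sum_congr rfl fun j _ => ?_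
  ring

lemma toLL_of_isLin {K : Type} [Field K] {m : ℕ} {L : (Fin m → K) → (Fin m → K)}
    (hL : IsLin K L) : toLL K m (fun i j => L (Pi.single j 1) i) = L := by
  apply isLin_ext (isLin_toLL _) hL
  intro i
  rw [toLL_single]

/-- `toB` as a linear map -/
def toBL (K : Type) [Field K] (m : ℕ) :
    (Fin m → Fin m → Fin m → K) →ₗ[K] ((Fin m → K) → (Fin m → K) → (Fin m → K)) where
  toFun := toB
  map_add' c c' := by
    ext x y k
    simp [toB, mul_add, Finset.sum_add_distrib]
  map_smul' a c := by
    ext x y k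
    simp [toB, Finset.mul_sum, mul_left_comm]

/-- tensors that are alternating and vanish on `𝒜` -/
def VA (K : Type) [Field K] {m : ℕ} (𝒜 : Set (Fin m × Fin m × Fin m)) :
    Submodule K (Fin m → Fin m → Fin m → K) where
  carrier := {v | (∀ i j k, v i j k = - v j i k) ∧ ∀ α ∈ 𝒜, v α.1 α.2.1 α.2.2 = 0}
  add_mem' := by
    rintro a b ⟨ha, ha'⟩ ⟨hb, hb'⟩
    refine ⟨fun i j k => ?_, fun α hα => ?_⟩
    · simp only [Pi.add_apply]
      rw [ha, hb]; ring
    · simp [ha' α hα, hb' α hα]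
  zero_mem' := by simp
  smul_mem' := by
    rintro t a ⟨ha, ha'⟩
    refine ⟨fun i j k => ?_, fun α hα => ?_⟩
    · simp only [Pi.smul_apply]
      rw [ha]; simp
    · simp [ha' α hα]

lemma isBilin_ekij {K : Type} [Field K] {m : ℕ} (i j k : Fin m) :
    IsBilin K (ekij (K := K) i j k) := by
  constructor <;>
  · intro a x x' y
    ext l
    simp only [ekij, Pi.add_apply, Pi.smul_apply, smul_eq_mul]
    ring

lemma coef_ekij {K : Type} [Field K] {m : ℕ} (i j k a b l : Fin m) :
    coef (ekij (K := K) i j k) a b l =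
      ((if i = a then 1 else 0) * (if j = b then 1 else 0) -
        (if j = a then 1 else 0) * (if i = b then 1 else 0)) * (if l = k then 1 else 0) := by
  simp [coef, ekij, Pi.single_apply]

lemma span_eq {K : Type} [Field K] [CharZero K] {m : ℕ} (𝒜 : Set (Fin m × Fin m × Fin m))
    (h𝒜 : ∀ α ∈ 𝒜, α.1 < α.2.1) :
    Submodule.span K {f | ∃ i j k : Fin m, i < j ∧ (i, j, k) ∉ 𝒜 ∧ f = ekij (K := K) i j k}
      = (VA K 𝒜).map (toBL K m) := by
  apply le_antisymm
  · rw [Submodule.span_le]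
    rintro _ ⟨i, j, k, hij, hn, rfl⟩
    refine ⟨coef (ekij i j k), ⟨?_, ?_⟩, toB_coef (isBilin_ekij i j k)⟩
    · intro a b l
      rw [coef_ekij, coef_ekij]; ring
    · rintro ⟨a, b, l⟩ hα
      have hab : a < b := h𝒜 _ hα
      rw [coef_ekij]
      dsimp only
      by_cases h1 : l = k
      · by_cases h2 : i = a ∧ j = b
        · exfalso
          obtain ⟨rfl, rfl⟩ := h2
          subst h1
          exact hn hα
        · by_cases h3 : j = a ∧ i = b
          · exfalso
            obtain ⟨rfl, rfl⟩ := h3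
            exact absurd hij (not_lt.mpr hab.le)
          · split_ifs <;> first | (exfalso; tauto) | simp
      · simp [h1]
  · rintro _ ⟨c, ⟨hc, hc'⟩, rfl⟩
    have hdec : c = ∑ i, ∑ j, ∑ k, (if i < j then c i j k else 0) •
        coef (ekij (K := K) i j k) := by
      ext a b l
      simp only [Finset.sum_apply, Pi.smul_apply, coef_ekij, smul_eq_mul]
      have : ∀ i j : Fin m, ∑ k, (if i < j then c i j k else 0) *
          (((if i = a then 1 else 0) * (if j = b then 1 else 0) -
            (if j = a then 1 else 0) * (if i = b then 1 else 0)) * (if l = k then 1 else 0)) =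
          (if i = a then (if j = b then (if i < j then c i j l else 0) else 0) else 0) -
          (if i = b then (if j = a then (if i < j then c i j l else 0) else 0) else 0) := by
        intro i j
        rw [Finset.sum_eq_single l]
        · rw [if_pos (rfl : l = l)]
          split_ifs <;> simp
        · intro k _ hk
          simp [Ne.symm hk]
        · simp
      simp only [this, Finset.sum_sub_distrib]
      rw [Finset.sum_eq_single a, Finset.sum_eq_single b, Finset.sum_eq_single b,
        Finset.sum_eq_single a]
      · simp only [if_true]
        rcases lt_trichotomy a b with h | h | h
        · simp [h, not_lt.mpr h.le]
        · subst h
          have := hc a a l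
          simp [self_eq_neg.mp this]
        · simp [h, not_lt.mpr h.le, hc a b l]
      all_goals simp +contextual
    have h2 : toBL K m c = ∑ i, ∑ j, ∑ k, (if i < j then c i j k else 0) •
        ekij (K := K) i j k := by
      conv_lhs => rw [hdec]
      simp only [map_sum, map_smul]
      refine Finset.sum_congr rfl fun i _ => Finset.sum_congr rfl fun j _ =>
        Finset.sum_congr rfl fun k _ => ?_
      congr 1
      exact toB_coef (isBilin_ekij i j k)
    rw [h2]
    refine Submodule.sum_mem _ fun i _ => Submodule.sum_mem _ fun j _ =>
        Submodule.sum_mem _ fun k _ => ?_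
    by_cases hij : i < j
    · by_cases hm : (i, j, k) ∈ 𝒜
      · have : c i j k = 0 := hc' _ hm
        simp [this]
      · exact Submodule.smul_mem _ _ (Submodule.subset_span ⟨i, j, k, hij, hm, rfl⟩)
    · simp [hij]

lemma isBilin_cob {K : Type} [Field K] {m : ℕ}
    {φ₀ : (Fin m → K) → (Fin m → K) → (Fin m → K)} (hbil : IsBilin K φ₀)
    {L : (Fin m → K) → (Fin m → K)} (hL : IsLin K L) : IsBilin K (cob φ₀ L) := by
  constructor
  · intro a x x' y
    simp only [cob]
    rw [hL, hbil.1, hbil.2, hbil.1, hL]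
    module
  · intro a x x' y
    simp only [cob]
    rw [hL, hbil.1, hbil.2, hbil.2, hL]
    module

lemma coef_cob {K : Type} [Field K] {m : ℕ}
    {φ₀ : (Fin m → K) → (Fin m → K) → (Fin m → K)} (hbil : IsBilin K φ₀)
    (W : Fin m → Fin m → K) : coef (cob φ₀ (toLL K m W)) = dd (coef φ₀) W := by
  obtain ⟨p, hp⟩ : ∃ p, p = coef φ₀ := ⟨_, rfl⟩
  rw [← hp]
  have h : ∀ (i : Fin m) (y : Fin m → K) (k : Fin m),
      φ₀ (Pi.single i 1) y k = ∑ l, p i l k * y l := by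
    intro i y k
    conv_lhs => rw [← toB_coef hbil, ← hp]
    simp [toB, Pi.single_apply, mul_comm]
  ext i j k
  simp only [coef, cob, dd, Pi.sub_apply, toLL_single, h, smul_eq_mul]
  congr 1
  rw [toLL_apply]
  refine Finset.sum_congr rfl fun l _ => ?_
  rw [h]
  simp [Pi.single_apply, mul_comm]

lemma K_split {K : Type} [Field K] [CharZero K] {m : ℕ}
    (φ₀ : (Fin m → K) → (Fin m → K) → (Fin m → K))
    (hbil : IsBilin K φ₀) (halt : ∀ x, φ₀ x x = 0)
    (𝒜 : Set (Fin m × Fin m × Fin m))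
    (h𝒜 : ∀ α ∈ 𝒜, α.1 < α.2.1)
    (hadm1 : ∀ ψ : (Fin m → K) → (Fin m → K) → (Fin m → K),
      IsBilin K ψ → (∀ x, ψ x x = 0) →
      ∃ v ∈ Submodule.span K {f | ∃ i j k : Fin m, i < j ∧ (i, j, k) ∉ 𝒜 ∧ f = ekij i j k},
        ∃ L, IsLin K L ∧ ψ = v + cob φ₀ L)
    (hadm2 : ∀ v ∈ Submodule.span K
        {f | ∃ i j k : Fin m, i < j ∧ (i, j, k) ∉ 𝒜 ∧ f = ekij (K := K) i j k},
      ∀ L, IsLin K L → v = cob φ₀ L → v = 0)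
    (W1 : Submodule K ((Fin m → K) → (Fin m → K)))
    (hW1a : ∀ L : (Fin m → K) → (Fin m → K), IsLin K L →
      ∃ d, (IsLin K d ∧ ∀ x y, d (φ₀ x y) = φ₀ (d x) y + φ₀ x (d y)) ∧
        ∃ w ∈ W1, L = d + w)
    (hW1lin : ∀ L ∈ W1, IsLin K L)
    (hW1b : ∀ w ∈ W1, (∀ x y, w (φ₀ x y) = φ₀ (w x) y + φ₀ x (w y)) → w = 0) :
    ∃ (r1 : (Fin m → Fin m → Fin m → K) →ₗ[K] (Fin m → Fin m → K))
      (r2 : (Fin m → Fin m → Fin m → K) →ₗ[K] (Fin m → Fin m → Fin m → K)),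
      (∀ c, toLL K m (r1 c) ∈ W1) ∧ (∀ c, r2 c ∈ VA K 𝒜) ∧
      (∀ c : Fin m → Fin m → Fin m → K, (∀ i j k, c i j k = - c j i k) →
        r2 c - dd (coef φ₀) (r1 c) = c) ∧
      (∀ w, toLL K m w ∈ W1 → ∀ v ∈ VA K 𝒜,
        r1 (v - dd (coef φ₀) w) = w ∧ r2 (v - dd (coef φ₀) w) = v) := by
  rw [span_eq 𝒜 h𝒜] at hadm1 hadm2
  obtain ⟨r1, r2, h1, h2, h3, h4⟩ := lin_split (W1.comap (toLL K m)) (VA K 𝒜) (VA K ∅)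
    (ddL (coef φ₀)) (by
      intro w hw v hv hvw
      have hvw' : v = dd (coef φ₀) w := hvw
      have hcob : toB v = cob φ₀ (toLL K m w) := by
        apply isBilin_ext (isBilin_toB v) (isBilin_cob hbil (isLin_toLL w))
        rw [coef_toB, coef_cob hbil, hvw']
      have h0 : toB v = 0 := hadm2 (toB v) ⟨v, hv, rfl⟩ _ (isLin_toLL w) hcob
      have hv0 : v = 0 := by
        rw [← coef_toB v, h0]; rfl
      refine ⟨?_, hv0⟩
      have hw0 : toLL K m w = 0 := by
        apply hW1b _ hw
        intro x y
        have : cob φ₀ (toLL K m w) x y = 0 := by rw [← hcob, h0]; rfl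
        simp only [cob] at this
        rw [bilin_anti hbil halt (toLL K m w x) y]
        rw [sub_eq_zero] at this
        rw [← this]; abel
      ext i j
      have := congrFun (toLL_single w j) i
      rw [hw0] at this
      exact this.symm) (by
      rintro c ⟨hc, -⟩
      obtain ⟨_, ⟨v, hv, rfl⟩, L, hL, hE⟩ := hadm1 (toB c) (isBilin_toB c) (toB_alt K hc)
      obtain ⟨d, ⟨hd, hd'⟩, w, hw, rfl⟩ := hW1a L hL
      have hw' := toLL_of_isLin (hW1lin w hw)
      have hcob : cob φ₀ (d + w) = cob φ₀ w := by
        ext x y k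
        have hx : φ₀ x ((d + w) y) = φ₀ x (d y) + φ₀ x (w y) := by
          simpa using hbil.2 1 x (d y) (w y)
        have hy : φ₀ y ((d + w) x) = φ₀ y (d x) + φ₀ y (w x) := by
          simpa using hbil.2 1 y (d x) (w x)
        have : cob φ₀ (d + w) x y = cob φ₀ w x y := by
          simp only [cob]
          rw [hx, hy, Pi.add_apply, hd' x y, bilin_anti hbil halt (d x) y]
          abel
        rw [this]
      rw [hcob, ← hw'] at hE
      refine ⟨-(fun i j => w (Pi.single j 1) i), ?_, v, hv, ?_⟩
      · apply Submodule.neg_mem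
        rw [Submodule.mem_comap, hw']
        exact hw
      · rw [map_neg, sub_neg_eq_add]
        change c = v + dd _ _
        rw [← coef_cob hbil, ← coef_toB c, hE]
        change coef (toB v) + _ = _
        rw [coef_toB]
        rfl)
  refine ⟨r1, r2, h1, h2, ?_, h4⟩
  intro c hc
  exact h3 c ⟨hc, by simp⟩

/-! ### The nonlinear equation in coordinates -/

lemma isLin_matMap {A : Type} [CommRing A] {m : ℕ} (W : Fin m → Fin m → A) :
    IsLin A (matMap W) := by
  intro a x y
  ext k
  simp only [matMap, Pi.add_apply, Pi.smul_apply, smul_eq_mul, mul_add, Finset.mul_sum,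
    Finset.sum_add_distrib, mul_left_comm]
  ring

lemma matMap_single {A : Type} [CommRing A] {m : ℕ} (W : Fin m → Fin m → A) (j : Fin m) :
    matMap W (Pi.single j 1) = (1 : A) • Pi.single j 1 + fun k => W k j := by
  ext k
  simp [matMap, Pi.single_apply]

/-- the higher-order terms -/
def QQ {A : Type} [CommRing A] {m : ℕ} (P n : Fin m → Fin m → Fin m → A)
    (W : Fin m → Fin m → A) (v : Fin m → Fin m → Fin m → A) (i j k : Fin m) : A :=
  n i j k + ∑ a, ∑ b, W a i * W b j * (P a b k + n a b k) + ∑ b, W b j * n i b k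
    + ∑ a, W a i * n a j k - ∑ l, W k l * v i j l

lemma toB_sum {A : Type} [CommRing A] {m : ℕ} (P n : Fin m → Fin m → Fin m → A)
    (x y : Fin m → A) : toB P x y + toB n x y = toB (P + n) x y := by
  ext k
  simp [toB, mul_add, Finset.sum_add_distrib]

lemma eqn_iff {K : Type} [Field K] {A : Type} [CommRing A] [Algebra K A] {m : ℕ}
    (p : Fin m → Fin m → Fin m → K) (hp : ∀ i j k, p i j k = - p j i k)
    (P : Fin m → Fin m → Fin m → A) (hP : ∀ i j k, P i j k = algebraMap K A (p i j k))
    (n v : Fin m → Fin m → Fin m → A) (W : Fin m → Fin m → A) :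
    (∀ x y, toB P (matMap W x) (matMap W y) + toB n (matMap W x) (matMap W y)
          = matMap W (toB P x y + toB v x y)) ↔
      v - dd p W = QQ P n W v := by
  have hs := isLin_matMap W
  have e1 : (∀ x y, toB P (matMap W x) (matMap W y) + toB n (matMap W x) (matMap W y)
          = matMap W (toB P x y + toB v x y)) ↔
      (fun x y => toB (P + n) (matMap W x) (matMap W y)) =
        (fun x y => matMap W (toB (P + v) x y)) := by
    simp only [toB_sum, funext_iff]
  have b1 : IsBilin A (fun x y => toB (P + n) (matMap W x) (matMap W y)) := by
    constructor
    · intro a x x' y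
      simp only [hs a x x', (isBilin_toB (P + n)).1]
    · intro a x y y'
      simp only [hs a y y', (isBilin_toB (P + n)).2]
  have b2 : IsBilin A (fun x y => matMap W (toB (P + v) x y)) := by
    constructor
    · intro a x x' y
      simp only [(isBilin_toB (P + v)).1, hs a]
    · intro a x y y'
      simp only [(isBilin_toB (P + v)).2, hs a]
  have e2 : (fun x y => toB (P + n) (matMap W x) (matMap W y)) =
        (fun x y => matMap W (toB (P + v) x y)) ↔
      ∀ i j k, toB (P + n) (matMap W (Pi.single i 1)) (matMap W (Pi.single j 1)) k =
        matMap W (toB (P + v) (Pi.single i 1) (Pi.single j 1)) k := by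
    constructor
    · intro h i j k
      exact congrFun (congrFun (congrFun h _) _) k
    · intro h
      apply isBilin_ext b1 b2
      ext i j k
      exact h i j k
  rw [e1, e2]
  have key : ∀ i j k, toB (P + n) (matMap W (Pi.single i 1)) (matMap W (Pi.single j 1)) k -
        matMap W (toB (P + v) (Pi.single i 1) (Pi.single j 1)) k =
      QQ P n W v i j k - (v - dd p W) i j k := by
    intro i j k
    rw [matMap_single, matMap_single, (isBilin_toB (P + n)).1, (isBilin_toB (P + n)).2,
      (isBilin_toB (P + n)).2]
    have f1 : ∀ (c : Fin m → Fin m → Fin m → A) l,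
        toB c (Pi.single i 1) (Pi.single j 1) l = c i j l :=
      fun c l => congrFun (congrFun (congrFun (coef_toB c) i) j) l
    have f2 : ∀ (c : Fin m → Fin m → Fin m → A) (y : Fin m → A),
        toB c (Pi.single i 1) y k = ∑ b, y b * c i b k := by
      intro c y
      simp [toB, Pi.single_apply]
    have f3 : ∀ (c : Fin m → Fin m → Fin m → A) (y : Fin m → A),
        toB c y (Pi.single j 1) k = ∑ b, y b * c b j k := by
      intro c y
      simp [toB, Pi.single_apply]
    have f4 : ∀ l, - (algebraMap K A (p j l k) * W l i) = W l i * P l j k := by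
      intro l
      rw [hP, hp l j k, map_neg]; ring
    simp only [one_smul, Pi.add_apply, f1, matMap]
    simp only [f2, f3, QQ, dd, Pi.sub_apply, Pi.add_apply,
      Algebra.smul_def, mul_add, Finset.sum_add_distrib, ← hP]
    simp only [toB, Pi.add_apply, mul_add, Finset.sum_add_distrib]
    have g1 : ∑ l, P i l k * W l j = ∑ l, W l j * P i l k :=
      Finset.sum_congr rfl fun l _ => mul_comm _ _
    have g2 : ∑ l, P j l k * W l i = - ∑ l, W l i * P l j k := by
      rw [← Finset.sum_neg_distrib]
      refine Finset.sum_congr rfl fun l _ => ?_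
      rw [← f4, hP, neg_neg]
    have g3 : ∑ l, P i j l * W k l = ∑ l, W k l * P i j l :=
      Finset.sum_congr rfl fun l _ => mul_comm _ _
    rw [g1, g2, g3]
    ring
  constructor
  · intro h
    ext i j k
    have := key i j k
    rw [h i j k, sub_self] at this
    exact (sub_eq_zero.mp this.symm).symm
  · intro h i j k
    have := key i j k
    rw [h, sub_self] at this
    exact sub_eq_zero.mp this

lemma QQ_anti {A : Type} [CommRing A] {m : ℕ}
    (P n : Fin m → Fin m → Fin m → A) (hP : ∀ i j k, P i j k = - P j i k)
    (hn : ∀ i j k, n i j k = - n j i k) (W : Fin m → Fin m → A)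
    (v : Fin m → Fin m → Fin m → A) (hv : ∀ i j k, v i j k = - v j i k) (i j k : Fin m) :
    QQ P n W v i j k = - QQ P n W v j i k := by
  have h1 : ∑ a, ∑ b, W a i * W b j * (P a b k + n a b k) =
      - ∑ a, ∑ b, W a j * W b i * (P a b k + n a b k) := by
    rw [Finset.sum_comm]
    simp only [← Finset.sum_neg_distrib]
    refine Finset.sum_congr rfl fun a _ => Finset.sum_congr rfl fun b _ => ?_
    rw [hP b a, hn b a]; ring
  have h2 : ∀ i j, ∑ b, W b j * n i b k = - ∑ a, W a j * n a i k := by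
    intro i j
    simp only [← Finset.sum_neg_distrib]
    refine Finset.sum_congr rfl fun a _ => ?_
    rw [hn i a]; ring
  have h3 : ∑ l, W k l * v i j l = - ∑ l, W k l * v j i l := by
    simp only [← Finset.sum_neg_distrib]
    refine Finset.sum_congr rfl fun a _ => ?_
    rw [hv i j]; ring
  simp only [QQ]
  rw [h1, h2 i j, h2 j i, h3, hn i j]
  ring

lemma mul_diff {A : Type} [CommRing A] {I : Ideal A} {n : ℕ} {a a' b b' : A}
    (hb : b ∈ I) (ha' : a' ∈ I) (h1 : a - a' ∈ I ^ n) (h2 : b - b' ∈ I ^ n) :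
    a * b - a' * b' ∈ I ^ (n + 1) := by
  have : a * b - a' * b' = (a - a') * b + (b - b') * a' := by ring
  rw [this, pow_succ]
  exact Ideal.add_mem _ (Ideal.mul_mem_mul h1 hb) (Ideal.mul_mem_mul h2 ha')

lemma QQ_mem {A : Type} [CommRing A] (I : Ideal A) {m : ℕ}
    (P n : Fin m → Fin m → Fin m → A) (hn : ∀ i j k, n i j k ∈ I) (W : Fin m → Fin m → A)
    (hW : ∀ i j, W i j ∈ I) (v : Fin m → Fin m → Fin m → A) (i j k : Fin m) :
    QQ P n W v i j k ∈ I := by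
  unfold QQ
  refine Ideal.sub_mem _ (Ideal.add_mem _ (Ideal.add_mem _ (Ideal.add_mem _ (hn _ _ _) ?_) ?_) ?_)
    ?_
  · exact Ideal.sum_mem _ fun a _ => Ideal.sum_mem _ fun b _ =>
      Ideal.mul_mem_right _ _ (Ideal.mul_mem_right _ _ (hW _ _))
  all_goals exact Ideal.sum_mem _ fun a _ => Ideal.mul_mem_right _ _ (hW _ _)

lemma QQ_contr {A : Type} [CommRing A] (I : Ideal A) {m : ℕ}
    (P n : Fin m → Fin m → Fin m → A) (hn : ∀ i j k, n i j k ∈ I)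
    (W W' : Fin m → Fin m → A) (v v' : Fin m → Fin m → Fin m → A)
    (hW : ∀ i j, W i j ∈ I) (hW' : ∀ i j, W' i j ∈ I)
    (hv : ∀ i j k, v i j k ∈ I) (N : ℕ)
    (h1 : ∀ i j, W i j - W' i j ∈ I ^ N) (h2 : ∀ i j k, v i j k - v' i j k ∈ I ^ N)
    (i j k : Fin m) : QQ P n W v i j k - QQ P n W' v' i j k ∈ I ^ (N + 1) := by
  have e : QQ P n W v i j k - QQ P n W' v' i j k =
      ∑ a, ∑ b, (W a i * W b j - W' a i * W' b j) * (P a b k + n a b k)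
      + ∑ b, (W b j * n i b k - W' b j * n i b k)
      + ∑ a, (W a i * n a j k - W' a i * n a j k)
      - ∑ l, (W k l * v i j l - W' k l * v' i j l) := by
    simp only [QQ, sub_mul, Finset.sum_sub_distrib]
    ring
  rw [e]
  have hz : ∀ x : A, x - x ∈ I ^ N := fun x => by simp
  refine Ideal.sub_mem _ (Ideal.add_mem _ (Ideal.add_mem _ ?_ ?_) ?_) ?_
  · exact Ideal.sum_mem _ fun a _ => Ideal.sum_mem _ fun b _ =>
      Ideal.mul_mem_right _ _ (mul_diff (hW _ _) (hW' _ _) (h1 _ _) (h1 _ _))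
  · exact Ideal.sum_mem _ fun a _ => mul_diff (hn _ _ _) (hW' _ _) (h1 _ _) (hz _)
  · exact Ideal.sum_mem _ fun a _ => mul_diff (hn _ _ _) (hW' _ _) (h1 _ _) (hz _)
  · exact Ideal.sum_mem _ fun a _ => mul_diff (hv _ _ _) (hW' _ _) (h1 _ _) (h2 _ _ _)

lemma smul_mem_ideal {K : Type} [Field K] {A : Type} [CommRing A] [Algebra K A] (I : Ideal A)
    (t : K) {a : A} (ha : a ∈ I) : t • a ∈ I := by
  rw [Algebra.smul_def]
  exact Ideal.mul_mem_left _ _ ha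

lemma extR_mem {K : Type} [Field K] {A : Type} [CommRing A] [Algebra K A] (I : Ideal A)
    {m : ℕ} (r : (Fin m → Fin m → Fin m → K) →ₗ[K] K) (c : Fin m → Fin m → Fin m → A)
    (hc : ∀ i j k, c i j k ∈ I) : extR r c ∈ I :=
  Ideal.sum_mem _ fun _ _ => Ideal.sum_mem _ fun _ _ => Ideal.sum_mem _ fun _ _ =>
    smul_mem_ideal I _ (hc _ _ _)

lemma extR_sub {K : Type} [Field K] {A : Type} [CommRing A] [Algebra K A]
    {m : ℕ} (r : (Fin m → Fin m → Fin m → K) →ₗ[K] K) (c c' : Fin m → Fin m → Fin m → A) :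
    extR r c - extR r c' = extR r (c - c') := by
  simp [extR, smul_sub, Finset.sum_sub_distrib]

lemma dd_mem {K : Type} [Field K] {A : Type} [CommRing A] [Algebra K A] (I : Ideal A)
    {m : ℕ} (p : Fin m → Fin m → Fin m → K) (W : Fin m → Fin m → A)
    (hW : ∀ i j, W i j ∈ I) (i j k : Fin m) : dd p W i j k ∈ I :=
  Ideal.sub_mem _ (Ideal.sub_mem _
    (Ideal.sum_mem _ fun _ _ => smul_mem_ideal I _ (hW _ _))
    (Ideal.sum_mem _ fun _ _ => smul_mem_ideal I _ (hW _ _)))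
    (Ideal.sum_mem _ fun _ _ => smul_mem_ideal I _ (hW _ _))

lemma exists_eta {K : Type} [Field K] [CharZero K] {m : ℕ}
    (A : Type) [CommRing A] [Algebra K A] [IsLocalRing A]
    (pr : A →ₐ[K] K)
    (hpr : ∀ a : A, a ∈ IsLocalRing.maximalIdeal A ↔ pr a = 0)
    (P : Fin m → Fin m → Fin m → A) (hP : ∀ i j k, P i j k = - P j i k)
    (W : Fin m → Fin m → A) (hW : ∀ i j, W i j ∈ IsLocalRing.maximalIdeal A)
    (v : (Fin m → A) → (Fin m → A) → (Fin m → A)) (hv : IsBilin A v) (hva : ∀ x, v x x = 0)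
    (hvm : ∀ i j k, coef v i j k ∈ IsLocalRing.maximalIdeal A) :
    ∃ η : (Fin m → A) → (Fin m → A) → (Fin m → A),
      (IsBilin A η ∧ (∀ x, η x x = 0) ∧ ∀ i j k : Fin m,
        η (Pi.single i 1) (Pi.single j 1) k ∈ IsLocalRing.maximalIdeal A) ∧
      ∀ x y, toB P (matMap W x) (matMap W y) + η (matMap W x) (matMap W y)
          = matMap W (toB P x y + v x y) := by
  let M : Matrix (Fin m) (Fin m) A := 1 + Matrix.of W
  have hM : ∀ x, matMap W x = M.mulVec x := by
    intro x
    ext k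
    simp [M, matMap, Matrix.mulVec, dotProduct, Matrix.one_apply, add_mul, Finset.sum_add_distrib]
  have hdet : IsUnit M.det := by
    rw [← IsLocalRing.notMem_maximalIdeal, hpr]
    have h1 : pr M.det = (M.map pr).det := by
      rw [AlgHom.map_det]; rfl
    have h2 : M.map pr = 1 := by
      ext i j
      have := (hpr _).mp (hW i j)
      by_cases h : i = j <;> simp [M, Matrix.one_apply, h] <;> simpa [h] using this
    rw [h1, h2]
    simp
  let s' : (Fin m → A) → (Fin m → A) := fun x => M⁻¹.mulVec x
  have hs' : IsLin A s' := by
    intro a x y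
    simp [s', Matrix.mulVec_add, Matrix.mulVec_smul]
  have hl : ∀ x, s' (matMap W x) = x := by
    intro x
    simp [s', hM, Matrix.mulVec_mulVec, Matrix.nonsing_inv_mul M hdet]
  have hr : ∀ x, matMap W (s' x) = x := by
    intro x
    simp [s', hM, Matrix.mulVec_mulVec, Matrix.mul_nonsing_inv M hdet]
  have hs := isLin_matMap W
  have hPb := isBilin_toB P
  have hs0 : matMap W 0 = 0 := by
    ext k; simp [matMap]
  refine ⟨fun x y => matMap W (toB P (s' x) (s' y) + v (s' x) (s' y)) - toB P x y,
    ⟨⟨?_, ?_⟩, ?_, ?_⟩, ?_⟩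
  · intro a x x' y
    simp only [hs' a, hPb.1, hv.1]
    rw [show ∀ p q r t : Fin m → A, a • p + q + (a • r + t) = a • (p + r) + (q + t) from
      fun p q r t => by module, hs]
    module
  · intro a x y y'
    simp only [hs' a, hPb.2, hv.2]
    rw [show ∀ p q r t : Fin m → A, a • p + q + (a • r + t) = a • (p + r) + (q + t) from
      fun p q r t => by module, hs]
    module
  · intro x
    simp only [toB_alt K hP, hva, add_zero, hs0, sub_zero]
  · intro i j k
    rw [hpr]
    have hprs : ∀ z l, pr (matMap W z l) = pr (z l) := by
      intro z l
      simp [matMap, fun j => (hpr _).mp (hW l j)]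
    have hx : ∀ x l, pr (s' x l) = pr (x l) := by
      intro x l
      rw [← hprs, hr]
    have hvz : ∀ x y, pr (v x y k) = 0 := by
      intro x y
      rw [← toB_coef hv]
      simp [toB, fun i j => (hpr _).mp (hvm i j k)]
    dsimp only
    rw [Pi.sub_apply, map_sub, hprs, Pi.add_apply, map_add, hvz]
    simp only [toB, map_sum, map_mul, hx]
    ring
  · intro x y
    simp only [hl]
    abel

/-- With `𝒜` an admissible set at `φ₀`, `V²_𝒜` the span of the basis
cochains off `𝒜`, `W¹` a complement of `Der(g)` in `End(V)`, and `A` a Noetherian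
complete local `K`-algebra with residue field `K`, the map
`f(w,v) = (id+w)∘(φ₀+v)∘((id+w)⁻¹ × (id+w)⁻¹) − φ₀`
is a bijection from `(𝔪⊗W¹) × (𝔪⊗V²_𝒜)` onto `𝔪⊗C²(V,V)`.  (The relation
`f(w,v) = η` is expressed in the equivalent inverse-free form
`Φ₀(sx,sy) + η(sx,sy) = s(Φ₀(x,y) + v(x,y))` where `s = id + w` and `Φ₀` is the
base change of `φ₀` to `A`.) -/
theorem stmt_5 {K : Type} [Field K] [CharZero K] [IsAlgClosed K] {m : ℕ}
    (φ₀ : (Fin m → K) → (Fin m → K) → (Fin m → K))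
    (hbil : IsBilin K φ₀) (halt : ∀ x, φ₀ x x = 0)
    (hjac : ∀ x y z, φ₀ (φ₀ x y) z + φ₀ (φ₀ y z) x + φ₀ (φ₀ z x) y = 0)
    -- the admissible set 𝒜 (a set of triples (i,j,k) with i < j)
    (𝒜 : Set (Fin m × Fin m × Fin m))
    (h𝒜 : ∀ α ∈ 𝒜, α.1 < α.2.1)
    (hadm1 : ∀ ψ : (Fin m → K) → (Fin m → K) → (Fin m → K),
      IsBilin K ψ → (∀ x, ψ x x = 0) →
      ∃ v ∈ Submodule.span K {f | ∃ i j k : Fin m, i < j ∧ (i, j, k) ∉ 𝒜 ∧ f = ekij i j k},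
        ∃ L, IsLin K L ∧ ψ = v + cob φ₀ L)
    (hadm2 : ∀ v ∈ Submodule.span K
        {f | ∃ i j k : Fin m, i < j ∧ (i, j, k) ∉ 𝒜 ∧ f = ekij (K := K) i j k},
      ∀ L, IsLin K L → v = cob φ₀ L → v = 0)
    -- `W¹`: a linear complement of `Z¹(g,g) = Der(g)` in `End_K(V)`
    (W1 : Submodule K ((Fin m → K) → (Fin m → K)))
    (hW1lin : ∀ L ∈ W1, IsLin K L)
    (hW1a : ∀ L : (Fin m → K) → (Fin m → K), IsLin K L →
      ∃ d, (IsLin K d ∧ ∀ x y, d (φ₀ x y) = φ₀ (d x) y + φ₀ x (d y)) ∧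
        ∃ w ∈ W1, L = d + w)
    (hW1b : ∀ w ∈ W1, (∀ x y, w (φ₀ x y) = φ₀ (w x) y + φ₀ x (w y)) → w = 0)
    -- `A`: a Noetherian complete local `K`-algebra with residue field `K`
    (A : Type) [CommRing A] [Algebra K A] [IsLocalRing A] [IsNoetherianRing A]
    (hcomplete : IsAdicComplete (IsLocalRing.maximalIdeal A) A)
    (pr : A →ₐ[K] K)
    (hpr : ∀ a : A, a ∈ IsLocalRing.maximalIdeal A ↔ pr a = 0) :
    -- `𝔪 ⊗ W¹`, as a set of matrices over `A`
    ∀ MW1 : Set (Fin m → Fin m → A),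
    (MW1 = (Submodule.span A {M | ∃ t ∈ IsLocalRing.maximalIdeal A, ∃ L ∈ W1,
        M = fun i j : Fin m => t * algebraMap K A (L (Pi.single j 1) i)} :
          Submodule A (Fin m → Fin m → A))) →
    -- `𝔪 ⊗ C²` and `𝔪 ⊗ V²_𝒜`
    ∀ MC2 M𝒜 : ((Fin m → A) → (Fin m → A) → (Fin m → A)) → Prop,
    (∀ η, MC2 η ↔ (IsBilin A η ∧ (∀ x, η x x = 0) ∧
      ∀ i j k : Fin m,
        η (Pi.single i 1) (Pi.single j 1) k ∈ IsLocalRing.maximalIdeal A)) →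
    (∀ v, M𝒜 v ↔ (MC2 v ∧ ∀ α ∈ 𝒜,
      v (Pi.single α.1 1) (Pi.single α.2.1 1) α.2.2 = 0)) →
    -- the base change `Φ₀` of `φ₀` to `A`
    ∀ Φ₀ : (Fin m → A) → (Fin m → A) → (Fin m → A),
    (∀ (x y : Fin m → A) (k : Fin m), Φ₀ x y k = ∑ i : Fin m, ∑ j : Fin m,
      x i * y j * algebraMap K A (φ₀ (Pi.single i 1) (Pi.single j 1) k)) →
    -- conclusion: `f` is a bijection from `(𝔪⊗W¹) × (𝔪⊗V²_𝒜)` onto `𝔪⊗C²`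
    ((∀ W ∈ MW1, ∀ v, M𝒜 v → ∃ η, MC2 η ∧
        ∀ x y, Φ₀ (matMap W x) (matMap W y) + η (matMap W x) (matMap W y)
          = matMap W (Φ₀ x y + v x y)) ∧
      (∀ η, MC2 η → ∃! Wv : (Fin m → Fin m → A) ×
          ((Fin m → A) → (Fin m → A) → (Fin m → A)),
        Wv.1 ∈ MW1 ∧ M𝒜 Wv.2 ∧
        ∀ x y, Φ₀ (matMap Wv.1 x) (matMap Wv.1 y) + η (matMap Wv.1 x) (matMap Wv.1 y)
          = matMap Wv.1 (Φ₀ x y + Wv.2 x y))) := by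
  intro MW1 hMW1 MC2 M𝒜 hMC2 hM𝒜 Φ₀ hΦ
  obtain ⟨r1, r2, h1, h2, h3, h4⟩ := K_split φ₀ hbil halt 𝒜 h𝒜 hadm1 hadm2 W1 hW1a hW1lin hW1b
  set I := IsLocalRing.maximalIdeal A with hI
  obtain ⟨p, hpdef⟩ : ∃ p, p = coef φ₀ := ⟨_, rfl⟩
  rw [← hpdef] at h3 h4
  have hp : ∀ i j k, p i j k = - p j i k := by
    intro i j k
    rw [hpdef]
    exact congrFun (bilin_anti hbil halt _ _) k
  let P : Fin m → Fin m → Fin m → A := fun i j k => algebraMap K A (p i j k)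
  have hPp : ∀ i j k, P i j k = algebraMap K A (p i j k) := fun _ _ _ => rfl
  have hP : ∀ i j k, P i j k = - P j i k := by
    intro i j k
    rw [hPp, hPp, hp, map_neg]
  have hΦP : Φ₀ = toB P := by
    ext x y k
    rw [hΦ]
    simp only [toB, hPp, hpdef, coef]
  subst hΦP
  -- facts on `𝔪 ⊗ W¹`
  have hWfacts : ∀ W ∈ MW1, (∀ i j, W i j ∈ I) ∧
      ∀ f : A →ₗ[K] K, toLL K m (fun i j => f (W i j)) ∈ W1 := by
    intro W hW
    rw [hMW1] at hW
    induction hW using Submodule.span_induction with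
    | mem M hM =>
      obtain ⟨t, ht, L, hL, rfl⟩ := hM
      refine ⟨fun i j => Ideal.mul_mem_right _ _ ht, fun f => ?_⟩
      have : (fun i j => f (t * algebraMap K A (L (Pi.single j 1) i))) =
          f t • fun i j : Fin m => L (Pi.single j 1) i := by
        ext i j
        rw [mul_comm, ← Algebra.smul_def, map_smul]
        simp [mul_comm]
      rw [this, map_smul, toLL_of_isLin (hW1lin L hL)]
      exact W1.smul_mem _ hL
    | zero =>
      refine ⟨fun i j => I.zero_mem, fun f => ?_⟩
      have : (fun i j : Fin m => f ((0 : Fin m → Fin m → A) i j)) = 0 := by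
        ext i j; simp
      rw [this, map_zero]
      exact W1.zero_mem
    | add M N _ _ hM hN =>
      refine ⟨fun i j => I.add_mem (hM.1 i j) (hN.1 i j), fun f => ?_⟩
      have : (fun i j : Fin m => f ((M + N) i j)) =
          (fun i j => f (M i j)) + fun i j => f (N i j) := by
        ext i j; simp
      rw [this, map_add]
      exact W1.add_mem (hM.2 f) (hN.2 f)
    | smul a M _ hM =>
      refine ⟨fun i j => I.mul_mem_left _ (hM.1 i j), fun f => ?_⟩
      exact hM.2 (f ∘ₗ LinearMap.mulLeft K a)
  -- scalar extensions
  let R1 : (Fin m → Fin m → Fin m → A) → (Fin m → Fin m → A) := fun c a b =>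
    extR (LinearMap.proj b ∘ₗ LinearMap.proj a ∘ₗ r1) c
  let R2 : (Fin m → Fin m → Fin m → A) → (Fin m → Fin m → Fin m → A) := fun c i j k =>
    extR (LinearMap.proj k ∘ₗ LinearMap.proj j ∘ₗ LinearMap.proj i ∘ₗ r2) c
  have R1d : ∀ c (f : A →ₗ[K] K) a b, f (R1 c a b) = r1 (fun i j k => f (c i j k)) a b := by
    intro c f a b
    simp only [R1, extR_dual]
    rfl
  have R2d : ∀ c (f : A →ₗ[K] K) a b d, f (R2 c a b d) = r2 (fun i j k => f (c i j k)) a b d := by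
    intro c f a b d
    simp only [R2, extR_dual]
    rfl
  have B1 : ∀ c, (∀ i j k, c i j k ∈ I) → R1 c ∈ MW1 := by
    intro c hc
    have : R1 c = ∑ i, ∑ j, ∑ k, fun a b => c i j k * algebraMap K A
        (toLL K m (r1 (Pi.single i (Pi.single j (Pi.single k 1)))) (Pi.single b 1) a) := by
      ext a b
      simp only [R1, extR, Finset.sum_apply, toLL_single, Algebra.smul_def]
      refine Finset.sum_congr rfl fun i _ => Finset.sum_congr rfl fun j _ =>
        Finset.sum_congr rfl fun k _ => ?_
      rw [mul_comm]
      rfl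
    rw [hMW1, this]
    exact Submodule.sum_mem _ fun i _ => Submodule.sum_mem _ fun j _ =>
      Submodule.sum_mem _ fun k _ => Submodule.subset_span ⟨_, hc i j k, _, h1 _, rfl⟩
  have B2 : ∀ c i j k, R2 c i j k = - R2 c j i k := by
    intro c i j k
    apply eq_of_dual (K := K)
    intro f
    rw [map_neg, R2d, R2d]
    exact (h2 _).1 i j k
  have B2' : ∀ c, ∀ α ∈ 𝒜, R2 c α.1 α.2.1 α.2.2 = 0 := by
    intro c α hα
    apply eq_of_dual (K := K)
    intro f
    rw [map_zero, R2d]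
    exact (h2 _).2 α hα
  have B3 : ∀ c : Fin m → Fin m → Fin m → A, (∀ i j k, c i j k = - c j i k) →
      R2 c - dd p (R1 c) = c := by
    intro c hc
    ext i j k
    apply eq_of_dual (K := K)
    intro f
    rw [Pi.sub_apply, Pi.sub_apply, Pi.sub_apply, map_sub, dd_dual, R2d]
    simp only [R1d]
    have := h3 (fun i j k => f (c i j k)) (by
      intro i j k
      rw [hc, map_neg])
    exact congrFun (congrFun (congrFun this i) j) k
  have B4 : ∀ W ∈ MW1, ∀ v : Fin m → Fin m → Fin m → A, (∀ i j k, v i j k = - v j i k) →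
      (∀ α ∈ 𝒜, v α.1 α.2.1 α.2.2 = 0) → R1 (v - dd p W) = W ∧ R2 (v - dd p W) = v := by
    intro W hW v hv hv'
    have hd : ∀ f : A →ₗ[K] K, (fun i j k => f ((v - dd p W) i j k)) =
        (fun i j k => f (v i j k)) - dd p (fun i j => f (W i j)) := by
      intro f
      ext i j k
      simp only [Pi.sub_apply, map_sub, dd_dual]
    have hvV : ∀ f : A →ₗ[K] K, (fun i j k => f (v i j k)) ∈ VA K 𝒜 := by
      intro f
      refine ⟨fun i j k => ?_, fun α hα => ?_⟩
      · dsimp only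
        rw [hv, map_neg]
      · dsimp only
        rw [hv' α hα, map_zero]
    constructor
    · ext i j
      apply eq_of_dual (K := K)
      intro f
      rw [R1d, hd, (h4 _ ((hWfacts W hW).2 f) _ (hvV f)).1]
    · ext i j k
      apply eq_of_dual (K := K)
      intro f
      rw [R2d, hd, (h4 _ ((hWfacts W hW).2 f) _ (hvV f)).2]
  refine ⟨?_, ?_⟩
  · intro W hW v hv
    rw [hM𝒜, hMC2] at hv
    obtain ⟨⟨hv1, hv2, hv3⟩, -⟩ := hv
    obtain ⟨η, hη, hE⟩ := exists_eta A pr hpr P hP W (hWfacts W hW).1 v hv1 hv2 hv3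
    exact ⟨η, (hMC2 η).mpr hη, hE⟩
  · intro η hη
    rw [hMC2] at hη
    obtain ⟨hη1, hη2, hη3⟩ := hη
    obtain ⟨n, hn⟩ : ∃ n, n = coef η := ⟨_, rfl⟩
    have hηn : η = toB n := by rw [hn, toB_coef hη1]
    have hna : ∀ i j k, n i j k = - n j i k := by
      intro i j k
      rw [hn]
      exact congrFun (bilin_anti hη1 hη2 _ _) k
    have hnm : ∀ i j k, n i j k ∈ I := by
      rw [hn]; exact hη3
    have R1m : ∀ (J : Ideal A) c, (∀ i j k, c i j k ∈ J) → ∀ i j, R1 c i j ∈ J :=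
      fun J c hc i j => extR_mem J _ _ hc
    have R2m : ∀ (J : Ideal A) c, (∀ i j k, c i j k ∈ J) → ∀ i j k, R2 c i j k ∈ J :=
      fun J c hc i j k => extR_mem J _ _ hc
    obtain ⟨c, ⟨hcm, hcf⟩, huniq⟩ := fixed_point I hcomplete
      (fun c => QQ P n (R1 c) (R2 c))
      (fun c hc => QQ_mem I P n hnm _ (R1m I c hc) _)
      (by
        intro c c' hc hc' N hN
        refine QQ_contr I P n hnm _ _ _ _ (R1m I c hc) (R1m I c' hc') (R2m I c hc) N ?_ ?_
        · intro i j
          simp only [R1, extR_sub]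
          exact extR_mem _ _ _ hN
        · intro i j k
          simp only [R2, extR_sub]
          exact extR_mem _ _ _ hN)
    dsimp only at hcf huniq
    have hca : ∀ i j k, c i j k = - c j i k := by
      intro i j k
      rw [← hcf]
      exact QQ_anti P n hP hna _ _ (B2 c) i j k
    refine ⟨(R1 c, toB (R2 c)), ⟨B1 c hcm, ?_, ?_⟩, ?_⟩
    · rw [hM𝒜, hMC2]
      have hh : ∀ i j k, toB (R2 c) (Pi.single i 1) (Pi.single j 1) k = R2 c i j k :=
        fun i j k => congrFun (congrFun (congrFun (coef_toB (R2 c)) i) j) k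
      refine ⟨⟨isBilin_toB _, toB_alt K (B2 c), fun i j k => ?_⟩, fun α hα => ?_⟩
      · dsimp only
        rw [hh]
        exact R2m I c hcm i j k
      · dsimp only
        rw [hh]
        exact B2' c α hα
    · rw [hηn]
      dsimp only
      rw [eqn_iff p hp P hPp, B3 c hca, hcf]
    · rintro ⟨W, v⟩ ⟨hW, hv, hE⟩
      replace hE : ∀ x y, toB P (matMap W x) (matMap W y) + η (matMap W x) (matMap W y)
          = matMap W (toB P x y + v x y) := hE
      replace hv : M𝒜 v := hv
      replace hW : W ∈ MW1 := hW
      rw [hM𝒜, hMC2] at hv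
      obtain ⟨⟨hv1, hv2, hv3⟩, hv4⟩ := hv
      rw [hηn, ← toB_coef hv1, eqn_iff p hp P hPp] at hE
      have hva : ∀ i j k, coef v i j k = - coef v j i k :=
        fun i j k => congrFun (bilin_anti hv1 hv2 _ _) k
      obtain ⟨e1, e2⟩ := B4 W hW (coef v) hva hv4
      have hc : coef v - dd p W = c := by
        apply huniq
        refine ⟨fun i j k => ?_, ?_⟩
        · exact I.sub_mem (hv3 i j k) (dd_mem I p W (hWfacts W hW).1 i j k)
        · rw [e1, e2, hE]
      rw [hc] at e1 e2
      rw [e1, e2, toB_coef hv1]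

end Stmt5
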